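/- Let K be a field of characteristic zero, R = K[x,y,z], and F = x²y + y²z. Then Ann_R(F) is equal to the ideal (z², xz, x² − yz, y³, xy²); in particular A(F) is not a complete intersection. -/

import Mathlib

open MvPolynomial

noncomputable section

variable {K : Type} [Field K] {n : ℕ}

/-- The endomorphism `∂^d = ∏ i, (∂/∂x_i)^{d i}`. -/
def monOp (n : ℕ) (K : Type) [CommSemiring K] (d : Fin n →₀ ℕ) :
    Module.End K (MvPolynomial (Fin n) K) :=
  ((List.finRange n).map fun i =>
    ((MvPolynomial.pderiv i).toLinearMap : Module.End K (MvPolynomial (Fin n) K)) ^ d i).prod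

/-- `contr F f = f(∂/∂x₁, …, ∂/∂xₙ) F`, i.e. the result of applying to `F` the
constant-coefficient differential operator obtained from `f` by substituting
`∂/∂x_i` for `x_i`; it is a linear map in `f`. -/
def contr (F : MvPolynomial (Fin n) K) :
    MvPolynomial (Fin n) K →ₗ[K] MvPolynomial (Fin n) K :=
  (basisMonomials (Fin n) K).constr K fun d => monOp n K d F

end

theorem pderiv_comm_apply {σ R : Type*} [CommSemiring R] (i j : σ) (p : MvPolynomial σ R) :
    pderiv i (pderiv j p) = pderiv j (pderiv i p) := by
  classical
  induction p using MvPolynomial.induction_on with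
  | C a => simp
  | add p q hp hq => simp [hp, hq]
  | mul_X p k h =>
    simp only [Derivation.leibniz, map_add, smul_eq_mul, pderiv_X, h]
    by_cases h1 : i = k <;> by_cases h2 : j = k <;>
      simp [h1, h2, eq_comm] <;> ring

theorem pderiv_two {σ R : Type*} [CommSemiring R] (i : σ) :
    pderiv i (2 : MvPolynomial σ R) = 0 := by
  exact_mod_cast (pderiv i).map_natCast 2

theorem monOp_apply_three {K : Type} [CommSemiring K] (d : Fin 3 →₀ ℕ)
    (F : MvPolynomial (Fin 3) K) :
    monOp 3 K d F = (pderiv 0)^[d 0] ((pderiv 1)^[d 1] ((pderiv 2)^[d 2] F)) := by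
  simp [monOp, List.finRange_succ, Module.End.pow_apply]

theorem monOp_single_add {K : Type} [CommSemiring K] (i : Fin 3) (d : Fin 3 →₀ ℕ)
    (F : MvPolynomial (Fin 3) K) :
    monOp 3 K (Finsupp.single i 1 + d) F = pderiv i (monOp 3 K d F) := by
  have comm (i j : Fin 3) : Function.Commute (pderiv (R := K) i) (pderiv j) :=
    pderiv_comm_apply i j
  simp only [monOp_apply_three]
  fin_cases i
  · simp [add_comm 1, Function.iterate_succ_apply']
  · simp [add_comm 1, Function.iterate_succ_apply']
    exact ((comm 1 0).iterate_right _ _).symm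
  · simp [add_comm 1, Function.iterate_succ_apply']
    rw [((comm 2 0).iterate_right _ _), ((comm 2 1).iterate_right _ _)]

theorem contr_monomial {K : Type} [Field K] {n : ℕ} (F : MvPolynomial (Fin n) K)
    (d : Fin n →₀ ℕ) (a : K) : contr F (monomial d a) = a • monOp n K d F := by
  have h : (monomial d a : MvPolynomial (Fin n) K) = a • basisMonomials (Fin n) K d := by
    simp [smul_monomial]
  rw [h, map_smul, contr, Module.Basis.constr_basis]

theorem contr_C {K : Type} [Field K] (F : MvPolynomial (Fin 3) K) (a : K) :
    contr F (C a) = C a * F := by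
  rw [← monomial_zero', contr_monomial, monOp_apply_three]
  simp [smul_eq_C_mul]

theorem contr_X_mul {K : Type} [Field K] (F : MvPolynomial (Fin 3) K) (i : Fin 3)
    (f : MvPolynomial (Fin 3) K) : contr F (X i * f) = pderiv i (contr F f) := by
  induction f using MvPolynomial.induction_on' with
  | monomial d a =>
    rw [X, monomial_mul, one_mul, contr_monomial, contr_monomial, monOp_single_add,
      Derivation.map_smul]
  | add p q hp hq => simp [mul_add, hp, hq]

theorem contr_X {K : Type} [Field K] (F : MvPolynomial (Fin 3) K) (i : Fin 3) :
    contr F (X i) = pderiv i F := by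
  rw [← mul_one (X i), contr_X_mul, ← C_1, contr_C, C_1, one_mul]

theorem contr_C_mul {K : Type} [Field K] {n : ℕ} (F : MvPolynomial (Fin n) K) (a : K)
    (f : MvPolynomial (Fin n) K) : contr F (C a * f) = C a * contr F f := by
  rw [← smul_eq_C_mul, map_smul, smul_eq_C_mul]

theorem contr_mul_eq_zero {K : Type} [Field K] {F f : MvPolynomial (Fin 3) K}
    (hf : contr F f = 0) (r : MvPolynomial (Fin 3) K) : contr F (r * f) = 0 := by
  induction r using MvPolynomial.induction_on with
  | C a => rw [contr_C_mul, hf, mul_zero]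
  | add p q hp hq => rw [add_mul, map_add, hp, hq, add_zero]
  | mul_X p i h => rw [mul_comm p, mul_assoc, contr_X_mul, h, map_zero]

/-- The ideal `(z², xz, x² − yz, y³, xy²)`. -/
noncomputable abbrev annIdeal (K : Type) [Field K] : Ideal (MvPolynomial (Fin 3) K) :=
  Ideal.span {(X 2) ^ 2, X 0 * X 2, (X 0) ^ 2 - X 1 * X 2, (X 1) ^ 3, X 0 * (X 1) ^ 2}

theorem gens_mem_annIdeal (K : Type) [Field K] :
    (X 2) ^ 2 ∈ annIdeal K ∧ X 0 * X 2 ∈ annIdeal K ∧ (X 0) ^ 2 - X 1 * X 2 ∈ annIdeal K ∧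
      (X 1) ^ 3 ∈ annIdeal K ∧ X 0 * (X 1) ^ 2 ∈ annIdeal K := by
  refine ⟨?_, ?_, ?_, ?_, ?_⟩ <;> exact Ideal.subset_span (by simp)

theorem contr_eq_zero_of_mem_annIdeal {K : Type} [Field K] {f : MvPolynomial (Fin 3) K}
    (hf : f ∈ annIdeal K) :
    contr ((X 0 : MvPolynomial (Fin 3) K) ^ 2 * X 1 + (X 1) ^ 2 * X 2) f = 0 := by
  induction hf using Submodule.span_induction with
  | zero => simp
  | add p q _ _ hp hq => rw [map_add, hp, hq, add_zero]
  | smul r p _ hp => exact contr_mul_eq_zero hp r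
  | mem p hp =>
    simp only [Set.mem_insert_iff, Set.mem_singleton_iff] at hp
    rcases hp with rfl | rfl | rfl | rfl | rfl <;>
      simp [sq, pow_three, contr_X_mul, contr_X, pderiv_X, mul_comm, mul_add]

/-- Modulo `annIdeal K`, the monomials `1, x, y, z, xy, y², yz, y²z` span. -/
theorem exists_normal_form {K : Type} [Field K] (f : MvPolynomial (Fin 3) K) :
    ∃ a : Fin 8 → K, f - (C (a 0) + C (a 1) * X 0 + C (a 2) * X 1 + C (a 3) * X 2 +
      C (a 4) * (X 0 * X 1) + C (a 5) * X 1 ^ 2 + C (a 6) * (X 1 * X 2) +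
      C (a 7) * (X 1 ^ 2 * X 2)) ∈ annIdeal K := by
  obtain ⟨hzz, hxz, hxx, hyyy, hxyy⟩ := gens_mem_annIdeal K
  induction f using MvPolynomial.induction_on with
  | C c => exact ⟨![c, 0, 0, 0, 0, 0, 0, 0], by simp⟩
  | add p q hp hq =>
    obtain ⟨a, ha⟩ := hp
    obtain ⟨b, hb⟩ := hq
    refine ⟨a + b, ?_⟩
    convert add_mem ha hb using 1
    simp only [Pi.add_apply, C_add]
    ring
  | mul_X p i hp =>
    obtain ⟨a, ha⟩ := hp
    have hp' := Ideal.mul_mem_right (X i) _ ha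
    have m {g : MvPolynomial (Fin 3) K} (r : MvPolynomial (Fin 3) K) (hg : g ∈ annIdeal K) :
        r * g ∈ annIdeal K := Ideal.mul_mem_left _ r hg
    fin_cases i
    · refine ⟨![0, a 0, 0, 0, a 2, 0, a 1, a 4], ?_⟩
      convert add_mem (add_mem (add_mem hp' (m (C (a 1) + C (a 4) * X 1) hxx))
        (m (C (a 3) + C (a 6) * X 1 + C (a 7) * X 1 ^ 2) hxz)) (m (C (a 5)) hxyy) using 1
      simp
      ring
    · refine ⟨![0, 0, a 0, 0, a 1, a 2, a 3, a 6], ?_⟩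
      convert add_mem (add_mem hp' (m (C (a 4)) hxyy))
        (m (C (a 5) + C (a 7) * X 2) hyyy) using 1
      simp
      ring
    · refine ⟨![0, 0, 0, a 0, 0, 0, a 2, a 5], ?_⟩
      convert add_mem (add_mem hp' (m (C (a 1) + C (a 4) * X 1) hxz))
        (m (C (a 3) + C (a 6) * X 1 + C (a 7) * X 1 ^ 2) hzz) using 1
      simp
      ring

theorem contr_normal_form {K : Type} [Field K] (a : Fin 8 → K) :
    contr ((X 0 : MvPolynomial (Fin 3) K) ^ 2 * X 1 + (X 1) ^ 2 * X 2)
      (C (a 0) + C (a 1) * X 0 + C (a 2) * X 1 + C (a 3) * X 2 +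
      C (a 4) * (X 0 * X 1) + C (a 5) * X 1 ^ 2 + C (a 6) * (X 1 * X 2) +
      C (a 7) * (X 1 ^ 2 * X 2)) =
    C (a 0) * (X 0 ^ 2 * X 1 + X 1 ^ 2 * X 2) + C (a 1) * (2 * X 0 * X 1) +
      C (a 2) * (X 0 ^ 2 + 2 * X 1 * X 2) + C (a 3) * X 1 ^ 2 + C (a 4) * (2 * X 0) +
      C (a 5) * (2 * X 2) + C (a 6) * (2 * X 1) + C (a 7) * 2 := by
  rw [show (C (a 0) + C (a 1) * X 0 + C (a 2) * X 1 + C (a 3) * X 2 +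
      C (a 4) * (X 0 * X 1) + C (a 5) * X 1 ^ 2 + C (a 6) * (X 1 * X 2) +
      C (a 7) * (X 1 ^ 2 * X 2) : MvPolynomial (Fin 3) K) =
      C (a 0) + X 0 * C (a 1) + X 1 * C (a 2) + X 2 * C (a 3) +
      X 0 * (X 1 * C (a 4)) + X 1 * (X 1 * C (a 5)) + X 1 * (X 2 * C (a 6)) +
      X 1 * (X 1 * (X 2 * C (a 7))) by ring]
  simp [contr_X_mul, contr_C, pderiv_X, pderiv_two]
  ring

theorem mem_annIdeal_of_contr_eq_zero {K : Type} [Field K] [CharZero K]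
    {f : MvPolynomial (Fin 3) K}
    (hf : contr ((X 0 : MvPolynomial (Fin 3) K) ^ 2 * X 1 + (X 1) ^ 2 * X 2) f = 0) :
    f ∈ annIdeal K := by
  obtain ⟨a, ha⟩ := exists_normal_form f
  have h := contr_eq_zero_of_mem_annIdeal ha
  rw [map_sub, hf, zero_sub, neg_eq_zero, contr_normal_form] at h
  have ev (x y z : K) := congrArg (eval ![x, y, z]) h
  simp at ev
  have e1 := ev 0 0 0
  have e2 := ev 1 0 0
  have e3 := ev (-1) 0 0
  have e4 := ev 0 0 1
  have e5 := ev 0 1 0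
  have e6 := ev 0 (-1) 0
  have e7 := ev 1 1 0
  have e8 := ev (-1) 1 0
  simp at e1 e2 e3 e4 e5 e6 e7 e8
  have h7 : a 7 = 0 := by grind
  have h5 : a 5 = 0 := by grind
  have h2 : a 2 = 0 := by grind
  have h4 : a 4 = 0 := by grind
  have h3 : a 3 = 0 := by grind
  have h6 : a 6 = 0 := by grind
  have h0 : a 0 = 0 := by grind
  have h1 : a 1 = 0 := by grind
  simpa [h0, h1, h2, h3, h4, h5, h6, h7] using ha

/-- The jets at the origin `(∂x∂z, ∂z², ∂x², ∂y³)`, which on `annIdeal K` factor through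
`annIdeal K / (x, y, z) annIdeal K`. -/
noncomputable def originJets {K : Type} [Field K] (f : MvPolynomial (Fin 3) K) : Fin 4 → K :=
  ![constantCoeff (pderiv 0 (pderiv 2 f)), constantCoeff (pderiv 2 (pderiv 2 f)),
    constantCoeff (pderiv 0 (pderiv 0 f)), constantCoeff (pderiv 1 (pderiv 1 (pderiv 1 f)))]

theorem originJets_add {K : Type} [Field K] (f g : MvPolynomial (Fin 3) K) :
    originJets (f + g) = originJets f + originJets g := by
  simp [originJets]

theorem low_jets_eq_zero {K : Type} [Field K] {h : MvPolynomial (Fin 3) K}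
    (hh : h ∈ annIdeal K) :
    constantCoeff h = 0 ∧ (∀ i, constantCoeff (pderiv i h) = 0) ∧ constantCoeff (pderiv 1 (pderiv 1 h)) = 0 := by
  induction hh using Submodule.span_induction with
  | zero => simp
  | add p q _ _ hp hq => simp [hp, hq]
  | smul r p _ hp => simp [hp]
  | mem p hp =>
    simp only [Set.mem_insert_iff, Set.mem_singleton_iff] at hp
    rcases hp with rfl | rfl | rfl | rfl | rfl <;> simp [pderiv_X]

theorem originJets_mul {K : Type} [Field K] (r : MvPolynomial (Fin 3) K)
    {h : MvPolynomial (Fin 3) K} (hh : h ∈ annIdeal K) :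
    originJets (r * h) = constantCoeff r • originJets h := by
  obtain ⟨h0, h1, h2⟩ := low_jets_eq_zero hh
  simp [originJets, h0, h1, h2]

theorem span_originJets_eq_top {K : Type} [Field K] [CharZero K]
    {ι : Type*} {g : ι → MvPolynomial (Fin 3) K}
    (hg : Ideal.span (Set.range g) = annIdeal K) :
    Submodule.span K (Set.range fun i => originJets (g i)) = ⊤ := by
  have mem {h : MvPolynomial (Fin 3) K} (hh : h ∈ annIdeal K) :
      originJets h ∈ Submodule.span K (Set.range fun i => originJets (g i)) := by
    rw [← hg] at hh
    induction hh using Submodule.span_induction with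
    | zero =>
      convert Submodule.zero_mem _
      ext i
      fin_cases i <;> simp [originJets]
    | add p q _ _ hp hq =>
      rw [originJets_add]
      exact add_mem hp hq
    | smul r p hp' hp =>
      rw [smul_eq_mul, originJets_mul r (hg ▸ hp')]
      exact Submodule.smul_mem _ _ hp
    | mem p hp =>
      obtain ⟨i, rfl⟩ := hp
      exact Submodule.subset_span ⟨i, rfl⟩
  obtain ⟨hzz, hxz, hxx, hyyy, -⟩ := gens_mem_annIdeal K
  refine eq_top_iff.2 fun v _ => ?_
  have key := add_mem (add_mem (add_mem
    (Submodule.smul_mem _ (v 0) (mem hxz)) (Submodule.smul_mem _ (v 1 / 2) (mem hzz)))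
    (Submodule.smul_mem _ (v 2 / 2) (mem hxx))) (Submodule.smul_mem _ (v 3 / 6) (mem hyyy))
  convert key using 1
  ext i
  fin_cases i <;> simp [originJets, pderiv_X, map_ofNat]
  ring

/-- For `F = x²y + y²z` in `K[x,y,z]` (char `K` = 0),
`Ann_R(F) = (z², xz, x² − yz, y³, xy²)`; in particular `A(F)` is not a
complete intersection (`Ann_R(F)` is not generated by a regular sequence of
three elements). Here `x = X 0`, `y = X 1`, `z = X 2`. -/
theorem ann_of_x_sq_y_add_y_sq_z {K : Type} [Field K] [CharZero K] :
    {f : MvPolynomial (Fin 3) K |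
        contr ((X 0 : MvPolynomial (Fin 3) K) ^ 2 * X 1 + (X 1) ^ 2 * X 2) f = 0}
      = ↑(Ideal.span ({(X 2) ^ 2, X 0 * X 2, (X 0) ^ 2 - X 1 * X 2, (X 1) ^ 3,
          X 0 * (X 1) ^ 2} : Set (MvPolynomial (Fin 3) K)))
    ∧ ¬ ∃ g : Fin 3 → MvPolynomial (Fin 3) K,
        RingTheory.Sequence.IsRegular (MvPolynomial (Fin 3) K) (List.ofFn g) ∧
        {f : MvPolynomial (Fin 3) K |
            contr ((X 0 : MvPolynomial (Fin 3) K) ^ 2 * X 1 + (X 1) ^ 2 * X 2) f = 0}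
          = ↑(Ideal.span (Set.range g)) := by
  have hann : {f : MvPolynomial (Fin 3) K |
      contr ((X 0 : MvPolynomial (Fin 3) K) ^ 2 * X 1 + (X 1) ^ 2 * X 2) f = 0}
      = ↑(annIdeal K) :=
    Set.ext fun _ => ⟨mem_annIdeal_of_contr_eq_zero, contr_eq_zero_of_mem_annIdeal⟩
  refine ⟨hann, ?_⟩
  rintro ⟨g, -, hg⟩
  have hgI : Ideal.span (Set.range g) = annIdeal K :=
    SetLike.coe_injective (hg.symm.trans hann)
  have hle := finrank_range_le_card (R := K) fun i => originJets (g i)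
  rw [Set.finrank, span_originJets_eq_top hgI] at hle
  simp at hle
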